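/- Let n ≥ 2 and let f : ℝⁿ → ℝ be locally Lipschitz, writing points of ℝⁿ as (t, x') with t ∈ ℝ and x' ∈ ℝ^{n−1}. Then for Lebesgue-almost every x' ∈ ℝ^{n−1} one has the fundamental theorem of calculus along the segment: f(1, x') − f(0, x') = ∫₀¹ ∂₁f(t, x') dt, where ∂₁f(t, x') denotes the Fréchet derivative of f at (t, x') applied to the first standard basis vector e₁ (defined for almost every t). -/

import Mathlib

open MeasureTheory

open Set Topology

/-- **Rademacher's theorem** for locally Lipschitz functions. -/
theorem LocallyLipschitz.ae_differentiableAt {E F : Type*}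
    [NormedAddCommGroup E] [NormedSpace ℝ E] [FiniteDimensional ℝ E]
    [MeasurableSpace E] [BorelSpace E]
    [NormedAddCommGroup F] [NormedSpace ℝ F] [FiniteDimensional ℝ F]
    {μ : Measure E} [μ.IsAddHaarMeasure] {f : E → F} (hf : LocallyLipschitz f) :
    ∀ᵐ x ∂μ, DifferentiableAt ℝ f x := by
  have := FiniteDimensional.proper ℝ E
  refine measure_null_of_locally_null _ fun x _ => ?_
  obtain ⟨K, t, ht, hK⟩ := hf x
  obtain ⟨u, hut, hu, hxu⟩ := mem_nhds_iff.1 ht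
  refine ⟨_, Filter.inter_mem self_mem_nhdsWithin
    (mem_nhdsWithin_of_mem_nhds (hu.mem_nhds hxu)), ?_⟩
  refine measure_mono_null ?_
    (ae_iff.1 ((hK.mono hut).ae_differentiableWithinAt_of_mem (μ := μ)))
  rintro y ⟨hy, hyu⟩ h
  exact hy ((h hyu).differentiableAt (hu.mem_nhds hyu))

/-- The fundamental theorem of calculus for locally Lipschitz functions of a real variable. -/
theorem LocallyLipschitz.integral_deriv_eq_sub {g : ℝ → ℝ} (hg : LocallyLipschitz g) (a b : ℝ) :
    ∫ t in a..b, deriv g t = g b - g a := by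
  obtain ⟨K, hK⟩ := hg.locallyLipschitzOn.exists_lipschitzOnWith_of_compact
    (isCompact_uIcc (a := a) (b := b))
  exact hK.absolutelyContinuousOnInterval.integral_deriv_eq_sub

/-- Segment lemma: for a locally Lipschitz `f` on `ℝⁿ = ℝ × ℝ^{n-1}` (`n ≥ 2`),
for a.e. `x'` the fundamental theorem of calculus holds along the segment
`t ↦ (t, x')`: `f (1, x') - f (0, x') = ∫₀¹ ∂₁ f (t, x') dt`, where
`∂₁ f (t, x')` is the Fréchet derivative of `f` at `(t, x')` applied to the
first standard basis vector `e₁ = (1, 0)`. -/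
theorem stmt_2 (m : ℕ) (hm : 1 ≤ m)
    (f : ℝ × EuclideanSpace ℝ (Fin m) → ℝ) (hf : LocallyLipschitz f) :
    ∀ᵐ x' ∂(volume : Measure (EuclideanSpace ℝ (Fin m))),
      f (1, x') - f (0, x') = ∫ t in (0:ℝ)..1, fderiv ℝ f (t, x') (1, 0) := by
  have hdiff : ∀ᵐ p ∂(volume : Measure ℝ).prod (volume : Measure (EuclideanSpace ℝ (Fin m))),
      DifferentiableAt ℝ f p := hf.ae_differentiableAt
  have hsegment := (Measure.ae_ae_comm (p := fun t x' => DifferentiableAt ℝ f (t, x'))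
    (measurableSet_of_differentiableAt ℝ f)).1 (Measure.ae_ae_of_ae_prod hdiff)
  filter_upwards [hsegment] with x' hx'
  refine ((hf.comp (LocallyLipschitz.prodMk_right x')).integral_deriv_eq_sub 0 1).symm.trans ?_
  refine intervalIntegral.integral_congr_ae ?_
  filter_upwards [hx'] with t ht _
  exact (ht.hasFDerivAt.comp_hasDerivAt t
    ((hasDerivAt_id t).prodMk (hasDerivAt_const t x'))).deriv
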